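/- Let Γ = ⟨S | R⟩ be a finitely presented group and let 𝒞 be a family of groups with bi-invariant metrics such that each (G, d) ∈ 𝒞 is a complete metric space. If Γ has the property of defect diminishing with respect to 𝒞, then there exist M > 0 and ε > 0 such that D(δ) ≤ 2M·δ for all 0 < δ < ε; in particular D ⪯ id. -/

import Mathlib

/-- A group equipped with a bi-invariant metric. -/
structure MetricGroup where
  carrier : Type
  [group : Group carrier]
  [metric : MetricSpace carrier]
  dist_left_invariant : ∀ g x y : carrier, dist (g * x) (g * y) = dist x y
  dist_right_invariant : ∀ g x y : carrier, dist (x * g) (y * g) = dist x y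

attribute [instance] MetricGroup.group MetricGroup.metric

/-- defect(φ) = max_{r ∈ R} d(φ(r), 1), where φ also denotes the induced
homomorphism F(S) → G. -/
noncomputable def defect {S : Type} [Fintype S] (R : Finset (FreeGroup S)) {G : MetricGroup}
    (φ : S → G.carrier) : ℝ :=
  ((R.sup fun r => nndist ((FreeGroup.lift φ) r) 1 : NNReal) : ℝ)

/-- dist(φ, ψ) = max_{s ∈ S} d(φ(s), ψ(s)). -/
noncomputable def mapDist {S : Type} [Fintype S] {G : MetricGroup} (φ ψ : S → G.carrier) : ℝ :=
  ((Finset.univ.sup fun s => nndist (φ s) (ψ s) : NNReal) : ℝ)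

/-- HomDist(φ) = inf over homomorphisms π : Γ → G of dist(φ, (π ∘ q)|_S),
where Γ = F(S)/⟨⟨R⟩⟩ and q is the quotient map. -/
noncomputable def homDist {S : Type} [Fintype S] (R : Finset (FreeGroup S)) {G : MetricGroup}
    (φ : S → G.carrier) : ℝ :=
  ⨅ π : (FreeGroup S ⧸ Subgroup.normalClosure (R : Set (FreeGroup S))) →* G.carrier,
    mapDist φ (fun s => π ((QuotientGroup.mk' _) (FreeGroup.of s)))

/-- D(δ) = sup { HomDist(φ) : φ : S → G, G ∈ 𝒞, defect(φ) < δ }, valued in [0, ∞]. -/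
noncomputable def Drate {S : Type} [Fintype S] (𝒞 : Set MetricGroup)
    (R : Finset (FreeGroup S)) (δ : ℝ) : ENNReal :=
  ⨆ (G : MetricGroup) (_ : G ∈ 𝒞) (φ : S → G.carrier) (_ : defect R φ < δ),
    ENNReal.ofReal (homDist R φ)

/-- A sequence of maps φₙ : S → Gₙ is an asymptotic homomorphism if
lim_{n→𝒰} defect(φₙ) = 0. -/
def IsAsymptoticHom {S : Type} [Fintype S] (𝒰 : Ultrafilter ℕ) (R : Finset (FreeGroup S))
    (G : ℕ → MetricGroup) (φ : ∀ n, S → (G n).carrier) : Prop :=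
  Filter.Tendsto (fun n => defect R (φ n)) (𝒰 : Filter ℕ) (nhds 0)

/-- φ' diminishes the defect of φ: (a) dist(φₙ, φ'ₙ) = O_𝒰(defect(φₙ)) and
(b) defect(φ'ₙ) = o_𝒰(defect(φₙ)). -/
def Diminishes {S : Type} [Fintype S] (𝒰 : Ultrafilter ℕ) (R : Finset (FreeGroup S))
    (G : ℕ → MetricGroup) (φ φ' : ∀ n, S → (G n).carrier) : Prop :=
  (∃ C : ℝ, 0 < C ∧ {n | mapDist (φ n) (φ' n) ≤ C * defect R (φ n)} ∈ 𝒰) ∧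
  (∃ ε : ℕ → ℝ, (∀ n, 0 ≤ ε n) ∧ Filter.Tendsto ε (𝒰 : Filter ℕ) (nhds 0) ∧
     ∀ n, defect R (φ' n) = ε n * defect R (φ n))

/-- The property of defect diminishing for the presentation ⟨S | R⟩ with respect to
the class 𝒞: every asymptotic homomorphism admits a sequence diminishing its defect. -/
def DefectDiminishing {S : Type} [Fintype S] (𝒰 : Ultrafilter ℕ) (𝒞 : Set MetricGroup)
    (R : Finset (FreeGroup S)) : Prop :=
  ∀ G : ℕ → MetricGroup, (∀ n, G n ∈ 𝒞) →
    ∀ φ : ∀ n, S → (G n).carrier, IsAsymptoticHom 𝒰 R G φ →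
      ∃ φ' : ∀ n, S → (G n).carrier, Diminishes 𝒰 R G φ φ'

open Filter Topology in
lemma ddAux_mul (G : MetricGroup) {a b : ℕ → G.carrier} {x y : G.carrier}
    (ha : Tendsto a atTop (𝓝 x)) (hb : Tendsto b atTop (𝓝 y)) :
    Tendsto (fun n => a n * b n) atTop (𝓝 (x * y)) := by
  rw [tendsto_iff_dist_tendsto_zero] at *
  refine squeeze_zero (fun _ => dist_nonneg) (fun n => ?_) (by simpa using ha.add hb)
  calc dist (a n * b n) (x * y) ≤ dist (a n * b n) (x * b n) + dist (x * b n) (x * y) :=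
        dist_triangle _ _ _
    _ = _ := by rw [G.dist_left_invariant, G.dist_right_invariant]

open Filter Topology in
lemma ddAux_inv (G : MetricGroup) {a : ℕ → G.carrier} {x : G.carrier}
    (ha : Tendsto a atTop (𝓝 x)) :
    Tendsto (fun n => (a n)⁻¹) atTop (𝓝 x⁻¹) := by
  rw [tendsto_iff_dist_tendsto_zero] at *
  refine ha.congr fun n => ?_
  rw [← G.dist_left_invariant (a n) (a n)⁻¹ x⁻¹, ← G.dist_right_invariant x _ (a n * x⁻¹)]
  simp [dist_comm]

open Filter Topology in
lemma ddAux_lift {S : Type} (G : MetricGroup) {a : ℕ → S → G.carrier} {x : S → G.carrier}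
    (ha : ∀ s, Tendsto (fun n => a n s) atTop (𝓝 (x s))) (w : FreeGroup S) :
    Tendsto (fun n => FreeGroup.lift (a n) w) atTop (𝓝 (FreeGroup.lift x w)) := by
  induction w using FreeGroup.induction_on with
  | C1 => simp
  | of s => simpa using ha s
  | inv_of s h => simpa using ddAux_inv G (ha s)
  | mul u v hu hv => simpa using ddAux_mul G hu hv

lemma ddAux_le_mapDist {S : Type} [Fintype S] {G : MetricGroup} (φ ψ : S → G.carrier) (s : S) :
    dist (φ s) (ψ s) ≤ mapDist φ ψ := by
  rw [← coe_nndist]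
  exact NNReal.coe_le_coe.2
    (Finset.le_sup (f := fun s => nndist (φ s) (ψ s)) (Finset.mem_univ s))

lemma ddAux_mapDist_le {S : Type} [Fintype S] {G : MetricGroup} (φ ψ : S → G.carrier) {c : ℝ}
    (hc : 0 ≤ c) (h : ∀ s, dist (φ s) (ψ s) ≤ c) : mapDist φ ψ ≤ c := by
  lift c to NNReal using hc
  exact NNReal.coe_le_coe.2 (Finset.sup_le fun s _ => by exact_mod_cast h s)

lemma ddAux_le_defect {S : Type} [Fintype S] (R : Finset (FreeGroup S)) {G : MetricGroup}
    (φ : S → G.carrier) {r : FreeGroup S} (hr : r ∈ R) :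
    dist (FreeGroup.lift φ r) 1 ≤ defect R φ := by
  rw [← coe_nndist]
  exact NNReal.coe_le_coe.2
    (Finset.le_sup (f := fun r => nndist (FreeGroup.lift φ r) 1) hr)

lemma ddAux_defect_nonneg {S : Type} [Fintype S] (R : Finset (FreeGroup S)) {G : MetricGroup}
    (φ : S → G.carrier) : 0 ≤ defect R φ := NNReal.coe_nonneg _

lemma ddAux_mapDist_nonneg {S : Type} [Fintype S] {G : MetricGroup}
    (φ ψ : S → G.carrier) : 0 ≤ mapDist φ ψ := NNReal.coe_nonneg _

/-- Uniform one-step improvement. -/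
lemma ddAux_step {S : Type} [Fintype S] (R : Finset (FreeGroup S))
    (𝒞 : Set MetricGroup) (𝒰 : Ultrafilter ℕ) (h𝒰 : (𝒰 : Filter ℕ) ≤ Filter.cofinite)
    (hdd : DefectDiminishing 𝒰 𝒞 R) :
    ∃ M : ℝ, 0 < M ∧ ∃ ε : ℝ, 0 < ε ∧ ∀ G ∈ 𝒞, ∀ φ : S → G.carrier, defect R φ < ε →
      ∃ φ' : S → G.carrier, mapDist φ φ' ≤ M * defect R φ ∧ defect R φ' ≤ 1 / 2 * defect R φ := by
  by_contra hcon
  push Not at hcon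
  have H := fun n : ℕ => hcon ((n : ℝ) + 1) (by positivity) (1 / ((n : ℝ) + 1)) (by positivity)
  choose G hG φ hφ hbad using H
  have h𝒰' : (𝒰 : Filter ℕ) ≤ Filter.atTop := by rwa [← Nat.cofinite_eq_atTop]
  have hasy : IsAsymptoticHom 𝒰 R G φ :=
    squeeze_zero (fun n => ddAux_defect_nonneg R _) (fun n => (hφ n).le)
      (tendsto_one_div_add_atTop_nhds_zero_nat.mono_left h𝒰')
  obtain ⟨φ', ⟨C, hC, hCm⟩, ε, hε0, hε, hεd⟩ := hdd G hG φ hasy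
  have h1 : ∀ᶠ n in (𝒰 : Filter ℕ), ε n < 1 / 2 := hε.eventually (gt_mem_nhds (by norm_num))
  have h2 : ∀ᶠ n : ℕ in (𝒰 : Filter ℕ), C ≤ n :=
    h𝒰' (tendsto_natCast_atTop_atTop.eventually (Filter.eventually_ge_atTop C))
  have h3 : ∀ᶠ n in (𝒰 : Filter ℕ), mapDist (φ n) (φ' n) ≤ C * defect R (φ n) := hCm
  obtain ⟨n, h1, h2, h3⟩ := (h1.and (h2.and h3)).exists
  have hd := ddAux_defect_nonneg R (φ n)
  have := hbad n (φ' n) (h3.trans (mul_le_mul_of_nonneg_right (by linarith) hd))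
  rw [hεd] at this
  exact absurd (mul_le_mul_of_nonneg_right h1.le hd) (not_le.2 this)

open Filter Topology in
lemma ddAux_homDist {S : Type} [Fintype S] (R : Finset (FreeGroup S)) (G : MetricGroup)
    [CompleteSpace G.carrier] {M ε : ℝ} (hM : 0 < M)
    (hstep : ∀ φ : S → G.carrier, defect R φ < ε →
      ∃ φ' : S → G.carrier, mapDist φ φ' ≤ M * defect R φ ∧ defect R φ' ≤ 1 / 2 * defect R φ)
    (φ : S → G.carrier) (hφ : defect R φ < ε) : homDist R φ ≤ 2 * M * defect R φ := by
  choose! f hf1 hf2 using hstep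
  set d := defect R φ with hd
  have hd0 : 0 ≤ d := ddAux_defect_nonneg R φ
  let a : ℕ → S → G.carrier := fun n => f^[n] φ
  have ha : ∀ n, a (n + 1) = f (a n) := fun n => Function.iterate_succ_apply' f n φ
  have hdef : ∀ n, defect R (a n) ≤ d / 2 ^ n := by
    intro n
    induction n with
    | zero => simp [a, hd]
    | succ n ih =>
      have hlt : defect R (a n) < ε :=
        (ih.trans (div_le_self hd0 (one_le_pow₀ (by norm_num)))).trans_lt hφ
      rw [ha]
      calc _ ≤ _ := hf2 _ hlt
        _ ≤ 1 / 2 * (d / 2 ^ n) := by gcongr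
        _ = _ := by rw [pow_succ]; field_simp
  have hlt : ∀ n, defect R (a n) < ε := fun n =>
    ((hdef n).trans (div_le_self hd0 (one_le_pow₀ (by norm_num)))).trans_lt hφ
  have hdist : ∀ s n, dist (a n s) (a (n + 1) s) ≤ (2 * M * d) / 2 / 2 ^ n := by
    intro s n
    calc _ ≤ mapDist (a n) (a (n + 1)) := ddAux_le_mapDist _ _ s
      _ ≤ M * defect R (a n) := by rw [ha]; exact hf1 _ (hlt n)
      _ ≤ M * (d / 2 ^ n) := by gcongr; exact hdef n
      _ = _ := by field_simp
  have hlim : ∀ s, ∃ x, Tendsto (fun n => a n s) atTop (𝓝 x) := fun s =>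
    cauchySeq_tendsto_of_complete (cauchySeq_of_le_geometric_two (hdist s))
  choose x hx using hlim
  have hker : ∀ r ∈ R, FreeGroup.lift x r = 1 := by
    intro r hr
    refine tendsto_nhds_unique (ddAux_lift G hx r) ?_
    rw [tendsto_iff_dist_tendsto_zero]
    refine squeeze_zero (fun _ => dist_nonneg)
      (fun n => (ddAux_le_defect R (a n) hr).trans (hdef n)) ?_
    have := (tendsto_pow_atTop_nhds_zero_of_lt_one (r := (1 / 2 : ℝ))
      (by norm_num) (by norm_num)).const_mul d
    simpa [div_eq_mul_inv] using this
  have hle : Subgroup.normalClosure (R : Set (FreeGroup S)) ≤ (FreeGroup.lift x).ker :=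
    Subgroup.normalClosure_le_normal fun r hr => hker r hr
  let π : (FreeGroup S ⧸ Subgroup.normalClosure (R : Set (FreeGroup S))) →* G.carrier :=
    QuotientGroup.lift _ (FreeGroup.lift x) hle
  refine (ciInf_le ⟨0, ?_⟩ π).trans (ddAux_mapDist_le _ _ (by positivity) fun s => ?_)
  · rintro _ ⟨p, rfl⟩
    exact ddAux_mapDist_nonneg _ _
  · have : π ((QuotientGroup.mk' _) (FreeGroup.of s)) = x s := by simp [π]
    rw [this]
    exact dist_le_of_le_geometric_two_of_tendsto₀ (hdist s) (hx s)

/-- If Γ = ⟨S | R⟩ has defect diminishing w.r.t. a class 𝒞 of groups with bi-invariant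
complete metrics, then there are M > 0 and ε > 0 with D(δ) ≤ 2M·δ for 0 < δ < ε;
in particular D ⪯ id. -/
theorem defect_diminishing_implies_linear_rate
    {S : Type} [Fintype S] (R : Finset (FreeGroup S))
    (𝒞 : Set MetricGroup) (hcomplete : ∀ G ∈ 𝒞, CompleteSpace G.carrier)
    (𝒰 : Ultrafilter ℕ) (h𝒰 : (𝒰 : Filter ℕ) ≤ Filter.cofinite)
    (hdd : DefectDiminishing 𝒰 𝒞 R) :
    (∃ M : ℝ, 0 < M ∧ ∃ ε : ℝ, 0 < ε ∧ ∀ δ : ℝ, 0 < δ → δ < ε →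
        Drate 𝒞 R δ ≤ ENNReal.ofReal (2 * M * δ)) ∧
    (∃ C : ℝ, 0 < C ∧ ∃ δ₀ : ℝ, 0 < δ₀ ∧ ∀ δ : ℝ, 0 < δ → δ ≤ δ₀ →
        Drate 𝒞 R δ ≤ ENNReal.ofReal (C * (C * δ) + C * δ)) := by
  obtain ⟨M, hM, ε, hε, hstep⟩ := ddAux_step R 𝒞 𝒰 h𝒰 hdd
  have key : ∀ δ : ℝ, 0 < δ → δ < ε → Drate 𝒞 R δ ≤ ENNReal.ofReal (2 * M * δ) := by
    intro δ hδ hδε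
    refine iSup_le fun G => iSup_le fun hG => iSup_le fun φ => iSup_le fun hφ => ?_
    have := hcomplete G hG
    refine ENNReal.ofReal_le_ofReal
      ((ddAux_homDist R G hM (hstep G hG) φ (hφ.trans hδε)).trans ?_)
    gcongr
  refine ⟨⟨M, hM, ε, hε, key⟩, 2 * M, by positivity, ε / 2, by positivity, fun δ h0 h1 => ?_⟩
  refine (key δ h0 (by linarith)).trans (ENNReal.ofReal_le_ofReal ?_)
  have : 0 ≤ 2 * M * (2 * M * δ) := by positivity
  linarith
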